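/- Pósa's theorem: Let G be a simple graph on n ≥ 3 vertices with degree sequence d(1) ≤ d(2) ≤ ... ≤ d(n) in increasing order. If for every k with 1 ≤ k < n/2 we have d(k) ≥ k + 1, then G is Hamiltonian. -/

import Mathlib

open SimpleGraph

theorem posa_close {V : Type*} [Fintype V] [DecidableEq V] (G : SimpleGraph V)
    (h3 : 3 ≤ Fintype.card V) {u v : V} (q : G.Walk v u) (hq : q.IsPath)
    (hl : q.length + 1 = Fintype.card V) (h : G.Adj u v) : G.IsHamiltonian := by
  intro _
  refine ⟨u, Walk.cons h q, ?_⟩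
  rw [Walk.isHamiltonianCycle_iff_isCycle_and_length_eq]
  refine ⟨?_, by simpa using hl⟩
  rw [Walk.cons_isCycle_iff]
  refine ⟨hq, fun hm => ?_⟩
  cases q with
  | nil => simp at hm
  | cons h' r =>
    rename_i w
    rw [Walk.cons_isPath_iff] at hq
    rw [Walk.edges_cons, List.mem_cons] at hm
    rcases hm with hm | hm
    · have : u = w := by
        have := h.ne
        grind
      subst this
      have := hq.1
      rw [Walk.isPath_iff_eq_nil] at this
      subst this
      simp at hl
      omega
    · exact hq.2 (Walk.snd_mem_support_of_mem_edges _ hm)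

theorem posa_cyc {V : Type*} [DecidableEq V] (G : SimpleGraph V) {u v : V}
    (p : (G ⊔ edge u v).Walk u u) (hp : p.IsCycle) (hm : s(u, v) ∈ p.edges) :
    ∃ q : G.Walk v u, q.IsPath ∧ q.length + 1 = p.length := by
  have key : ∀ p : (G ⊔ edge u v).Walk u u, p.IsCycle → p.snd = v →
      ∃ q : G.Walk v u, q.IsPath ∧ q.length + 1 = p.length := by
    intro p hp hs
    cases p with
    | nil => simp at hp
    | cons h r =>
      simp at hs
      subst hs
      rw [Walk.cons_isCycle_iff] at hp
      have ht : ∀ e ∈ r.edges, e ∈ G.edgeSet := by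
        intro e he
        have := Walk.edges_subset_edgeSet _ he
        have hne : e ≠ s(u, _) := fun h => hp.2 (h ▸ he)
        induction e with | h x y
        simp [edge_adj] at this
        simp at hne ⊢
        grind
      exact ⟨r.transfer G ht, hp.1.transfer ht, by simp⟩
  have := hp.neighborSet_toSubgraph_endpoint
  have hv : v ∈ p.toSubgraph.neighborSet u := by
    simpa [Walk.adj_toSubgraph_iff_mem_edges] using hm
  rw [this] at hv
  rcases hv with hv | hv
  · exact key p hp hv.symm
  · obtain ⟨q, h1, h2⟩ := key p.reverse hp.reverse (by simpa using hv.symm)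
    exact ⟨q, h1, by simpa using h2⟩

theorem posa_path {V : Type*} [Fintype V] [DecidableEq V] (G : SimpleGraph V)
    {u v : V} (h3 : 3 ≤ Fintype.card V) (hG : ¬ G.IsHamiltonian)
    (h : (G ⊔ edge u v).IsHamiltonian) :
    ∃ q : G.Walk v u, q.IsPath ∧ q.length + 1 = Fintype.card V := by
  haveI : Nontrivial V := Fintype.one_lt_card_iff_nontrivial.1 (by omega)
  obtain ⟨p, hp⟩ := h.exists_isHamiltonianCycle u
  rw [Walk.isHamiltonianCycle_iff_isCycle_and_length_eq] at hp
  by_cases hm : s(u, v) ∈ p.edges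
  · rw [← hp.2]; exact posa_cyc G p hp.1 hm
  · exfalso
    apply hG
    intro _
    have ht : ∀ e ∈ p.edges, e ∈ G.edgeSet := by
      intro e he
      have := Walk.edges_subset_edgeSet _ he
      have hne : e ≠ s(u, v) := fun h => hm (h ▸ he)
      induction e with | h x y
      simp [edge_adj] at this
      simp at hne ⊢
      grind
    refine ⟨u, p.transfer G ht, ?_⟩
    rw [Walk.isHamiltonianCycle_iff_isCycle_and_length_eq]
    exact ⟨hp.1.transfer ht, by simpa using hp.2⟩

theorem posa_ore {V : Type*} [Fintype V] [DecidableEq V] (G : SimpleGraph V) [DecidableRel G.Adj]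
    {u v : V} (h3 : 3 ≤ Fintype.card V) (hG : ¬ G.IsHamiltonian)
    (q : G.Walk v u) (hq : q.IsPath) (hl : q.length + 1 = Fintype.card V) :
    G.degree u + G.degree v < Fintype.card V := by
  by_contra hc
  have hham : q.IsHamiltonian :=
    Walk.isHamiltonian_iff_isPath_and_length_eq.2 ⟨hq, by omega⟩
  have hsurj : ∀ w, ∃ i ≤ q.length, q.getVert i = w := fun w => by
    obtain ⟨i, h1, h2⟩ := Walk.mem_support_iff_exists_getVert.1 (hham.mem_support w)
    exact ⟨i, h2, h1⟩
  let A := (Finset.range q.length).filter fun i => G.Adj u (q.getVert i)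
  let B := (Finset.range q.length).filter fun i => G.Adj v (q.getVert (i + 1))
  have hA : G.degree u ≤ A.card := by
    rw [← card_neighborFinset_eq_degree]
    refine le_trans (Finset.card_le_card ?_) (Finset.card_image_le (f := q.getVert))
    intro w hw
    rw [mem_neighborFinset] at hw
    obtain ⟨i, hi, rfl⟩ := hsurj w
    refine Finset.mem_image.2 ⟨i, ?_, rfl⟩
    rw [Finset.mem_filter, Finset.mem_range]
    refine ⟨lt_of_le_of_ne hi ?_, hw⟩
    rintro rfl
    simp at hw
  have hB : G.degree v ≤ B.card := by
    rw [← card_neighborFinset_eq_degree]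
    refine le_trans (Finset.card_le_card ?_) (Finset.card_image_le (f := fun i => q.getVert (i + 1)))
    intro w hw
    rw [mem_neighborFinset] at hw
    obtain ⟨i, hi, rfl⟩ := hsurj w
    cases i with
    | zero => simp at hw
    | succ i =>
      refine Finset.mem_image.2 ⟨i, ?_, rfl⟩
      rw [Finset.mem_filter, Finset.mem_range]
      exact ⟨by omega, hw⟩
  have hAB : (A ∩ B).Nonempty := by
    rw [← Finset.card_pos]
    have h1 := Finset.card_union_add_card_inter A B
    have h2 : (A ∪ B).card ≤ q.length := by
      rw [← Finset.card_range q.length]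
      exact Finset.card_le_card (Finset.union_subset (Finset.filter_subset _ _) (Finset.filter_subset _ _))
    omega
  obtain ⟨i, hi⟩ := hAB
  simp only [A, B, Finset.mem_inter, Finset.mem_filter, Finset.mem_range] at hi
  obtain ⟨⟨hi, hu⟩, -, hv⟩ := hi
  let r := (q.take i).append (Walk.cons hu.symm (q.drop (i + 1)).reverse)
  have hperm : r.support.Perm q.support := by
    have : r.support = (q.take i).support ++ (q.drop (i+1)).support.reverse := by
      simp [r, Walk.support_append]
    rw [this, Walk.support_take, Walk.drop_support_eq_support_drop_min,
      min_eq_left (by omega)]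
    refine ((List.reverse_perm _).append_left _).trans ?_
    rw [List.take_append_drop]
  refine hG (posa_close G h3 r ?_ ?_ hv.symm)
  · rw [Walk.isPath_def, hperm.nodup_iff]; exact hq.support_nodup
  · have := hperm.length_eq
    simp at this
    omega

theorem posa_top {V : Type*} [Fintype V] [DecidableEq V] (h3 : 3 ≤ Fintype.card V) :
    (⊤ : SimpleGraph V).IsHamiltonian := by
  have : ∀ k, k < Fintype.card V →
      ∃ u v, ∃ q : (⊤ : SimpleGraph V).Walk v u, q.IsPath ∧ q.length = k := by
    intro k
    induction k with
    | zero =>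
      intro h
      obtain ⟨a⟩ := Fintype.card_pos_iff.1 h
      exact ⟨a, a, Walk.nil, by simp, rfl⟩
    | succ k ih =>
      intro h
      obtain ⟨u, v, q, hq, hl⟩ := ih (by omega)
      have : ∃ w, w ∉ q.support := by
        by_contra! hc
        have := (hq.isHamiltonian_of_mem hc).length_eq
        omega
      obtain ⟨w, hw⟩ := this
      have hwv : w ≠ v := by rintro rfl; simp at hw
      exact ⟨u, w, Walk.cons (by simpa using hwv) q, by simp [Walk.cons_isPath_iff, hq, hw], by simp [hl]⟩
  obtain ⟨u, v, q, hq, hl⟩ := this (Fintype.card V - 1) (by omega)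
  refine posa_close _ h3 q hq (by omega) ?_
  simp only [top_adj]
  rintro rfl
  rw [Walk.isPath_iff_eq_nil] at hq
  subst hq
  simp at hl
  omega

theorem posa_core {V : Type*} [Fintype V] [DecidableEq V] (h3 : 3 ≤ Fintype.card V)
    (G : SimpleGraph V) [DecidableRel G.Adj]
    (hcount : ∀ k, 1 ≤ k → 2 * k < Fintype.card V →
      (Finset.univ.filter fun v => G.degree v ≤ k).card < k) : G.IsHamiltonian := by
  classical
  by_contra hG
  obtain ⟨H, hGH, hH⟩ := (Set.toFinite {H : SimpleGraph V | ¬ H.IsHamiltonian}).exists_le_maximal hG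
  have hHn : ¬ H.IsHamiltonian := hH.prop
  have hcH : ∀ k, 1 ≤ k → 2 * k < Fintype.card V →
      (Finset.univ.filter fun v => H.degree v ≤ k).card < k := by
    intro k h1 h2
    refine lt_of_le_of_lt (Finset.card_le_card ?_) (hcount k h1 h2)
    intro v hv
    simp only [Finset.mem_filter, Finset.mem_univ, true_and] at hv ⊢
    exact (degree_le_of_le hGH).trans hv
  have hore : ∀ u v, u ≠ v → ¬ H.Adj u v → H.degree u + H.degree v < Fintype.card V := by
    intro u v hne hadj
    have h1 : (H ⊔ edge u v).IsHamiltonian := by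
      by_contra hc
      exact (hH.not_prop_of_gt (lt_sup_edge H u v hne hadj)) hc
    obtain ⟨q, hq, hl⟩ := posa_path H h3 hHn h1
    exact posa_ore H h3 hHn q hq hl
  let S : Finset (V × V) := Finset.univ.filter fun x => x.1 ≠ x.2 ∧ ¬ H.Adj x.1 x.2
  have hS : S.Nonempty := by
    by_contra hc
    rw [Finset.not_nonempty_iff_eq_empty, Finset.filter_eq_empty_iff] at hc
    apply hHn
    have : H = ⊤ := by
      ext a b
      have := hc (Finset.mem_univ (a, b))
      simp only [top_adj]
      exact ⟨fun h => h.ne, fun h => by by_contra h'; exact this ⟨h, h'⟩⟩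
    rw [this]
    exact posa_top h3
  obtain ⟨⟨u, v⟩, huv, hmax⟩ := S.exists_max_image (fun x => H.degree x.1 + H.degree x.2) hS
  simp only [S, Finset.mem_filter, Finset.mem_univ, true_and, Prod.forall] at huv hmax
  have main : ∀ u v, u ≠ v → ¬ H.Adj u v → (∀ a b, a ≠ b ∧ ¬ H.Adj a b →
      H.degree a + H.degree b ≤ H.degree u + H.degree v) → H.degree u ≤ H.degree v → False := by
    intro u v hne hadj hmax hle
    have hlt := hore u v hne hadj
    rcases Nat.eq_zero_or_pos (H.degree u) with h0 | h0
    · have := hcH 1 le_rfl (by omega)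
      rw [Nat.lt_one_iff, Finset.card_eq_zero, Finset.filter_eq_empty_iff] at this
      exact this (Finset.mem_univ u) (by omega)
    · have h1 := hcH (H.degree u) h0 (by omega)
      have h2 : (insert v (H.neighborFinset v))ᶜ.card ≤
          (Finset.univ.filter fun w => H.degree w ≤ H.degree u).card := by
        refine Finset.card_le_card ?_
        intro w hw
        simp only [Finset.mem_compl, Finset.mem_insert, mem_neighborFinset, not_or] at hw
        simp only [Finset.mem_filter, Finset.mem_univ, true_and]
        have := hmax w v ⟨hw.1, fun h => hw.2 h.symm⟩
        omega
      rw [Finset.card_compl, Finset.card_insert_of_notMem (by simp),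
        card_neighborFinset_eq_degree] at h2
      omega
  rcases le_total (H.degree u) (H.degree v) with h | h
  · exact main u v huv.1 huv.2 hmax h
  · exact main v u huv.1.symm (fun h => huv.2 h.symm)
      (fun a b hab => by have := hmax a b hab; omega) h

theorem deg_aux {V : Type*} [Fintype V] (G : SimpleGraph V) [DecidableRel G.Adj]
    {a b : V} (h : a = b) : G.degree a = G.degree b := by
  subst h; rfl

/-- Pósa's theorem: if `G` is a simple graph on `n ≥ 3` vertices whose degree sequence
`d(1) ≤ d(2) ≤ … ≤ d(n)` (listed in increasing order via the monotone enumeration `e`,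
with the `k`-th smallest degree being `G.degree (e ⟨k-1, _⟩)`) satisfies `d(k) ≥ k + 1`
for every `1 ≤ k < n/2`, then `G` is Hamiltonian. -/
theorem posa {V : Type*} [Fintype V] [DecidableEq V]
    (G : SimpleGraph V) [DecidableRel G.Adj]
    (n : ℕ) (hn : n = Fintype.card V) (h3 : 3 ≤ n)
    (e : Fin n ≃ V) (hmono : Monotone fun i => G.degree (e i))
    (hdeg : ∀ i : Fin n, 2 * ((i : ℕ) + 1) < n → (i : ℕ) + 2 ≤ G.degree (e i)) :
    G.IsHamiltonian := by
  subst hn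
  refine posa_core h3 G ?_
  intro k h1 h2
  have hd := hdeg ⟨k - 1, by omega⟩ (by simp only; omega)
  simp only at hd
  have hsub : (Finset.univ.filter fun v => G.degree v ≤ k) ⊆
      (Finset.univ.filter fun i : Fin (Fintype.card V) => (i : ℕ) < k - 1).image e := by
    intro v hv
    simp only [Finset.mem_filter, Finset.mem_univ, true_and] at hv
    refine Finset.mem_image.2 ⟨e.symm v, ?_, by simp⟩
    simp only [Finset.mem_filter, Finset.mem_univ, true_and]
    by_contra hc
    have hm := hmono (a := ⟨k - 1, by omega⟩) (b := e.symm v) (by rw [Fin.le_def]; simp only; omega)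
    simp only at hm
    have hev : G.degree (e (e.symm v)) = G.degree v := deg_aux G (e.apply_symm_apply v)
    omega
  have hcard := (Finset.card_le_card hsub).trans Finset.card_image_le
  have h5 : (Finset.univ.filter fun i : Fin (Fintype.card V) => (i : ℕ) < k - 1).card ≤ k - 1 := by
    rw [← Finset.card_range (k - 1)]
    exact Finset.card_le_card_of_injOn (fun i => (i : ℕ)) (fun i hi => by simpa using hi)
      (fun a _ b _ h => Fin.ext h)
  omega
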